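/- arXiv:2308.11109 — 2 statements merged into one kernel-verified Lean document; each statement's English description precedes it below -/
import Mathlib

section
/- Let (x_n)_{n≥0} be a sequence of integers with |x_{n+1} − x_n| ≤ 1 for all n, and let r_n = |{x_0, x_1, …, x_n}| be the number of distinct values taken up to time n. If x_n/n → ℓ as n → ∞ for some real ℓ, then r_n/n → |ℓ| as n → ∞. -/
open Filter

/-- The discrete range of a sequence: the number of distinct values among `x 0, …, x n`. -/
def discreteRange (x : ℕ → ℤ) (n : ℕ) : ℕ :=
  ((Finset.range (n + 1)).image x).card

/-- A discrete intermediate value theorem for integer sequences with steps bounded by one. -/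
lemma uIcc_subset_image_range {x : ℕ → ℤ} (hstep : ∀ n : ℕ, |x (n + 1) - x n| ≤ 1) (n : ℕ) :
    Finset.uIcc (x 0) (x n) ⊆ (Finset.range (n + 1)).image x := by
  induction n with
  | zero => simp
  | succ n ih =>
    intro y hy
    rw [Finset.range_add_one, Finset.image_insert, Finset.mem_insert]
    by_cases hyn : y = x (n + 1)
    · exact Or.inl hyn
    · refine Or.inr (ih ?_)
      have h := abs_le.mp (hstep n)
      rw [Finset.mem_uIcc'] at hy ⊢
      omega

lemma abs_sub_lt_discreteRange {x : ℕ → ℤ} (hstep : ∀ n : ℕ, |x (n + 1) - x n| ≤ 1) (n : ℕ) :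
    (|x n - x 0| : ℝ) < discreteRange x n := by
  have h := Finset.card_le_card (uIcc_subset_image_range hstep n)
  rw [Int.card_uIcc] at h
  have h' : |x n - x 0| < (discreteRange x n : ℤ) := by
    rw [Int.abs_eq_natAbs]
    unfold discreteRange
    omega
  exact_mod_cast h'

lemma discreteRange_le_of_forall_mem_Icc {x : ℕ → ℤ} {n : ℕ} {a b : ℝ}
    (h : ∀ k ≤ n, (x k : ℝ) ∈ Set.Icc a b) : (discreteRange x n : ℝ) ≤ b - a + 1 := by
  have hsub : (Finset.range (n + 1)).image x ⊆ Finset.Icc ⌈a⌉ ⌊b⌋ := by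
    intro y hy
    obtain ⟨k, hk, rfl⟩ := Finset.mem_image.mp hy
    have hk' := h k (Nat.lt_succ_iff.mp (Finset.mem_range.mp hk))
    exact Finset.mem_Icc.mpr ⟨Int.ceil_le.mpr hk'.1, Int.le_floor.mpr hk'.2⟩
  have hcard := Finset.card_le_card hsub
  have hab : ⌈a⌉ ≤ ⌊b⌋ :=
    (Int.ceil_le.mpr (h 0 n.zero_le).1).trans (Int.le_floor.mpr (h 0 n.zero_le).2)
  rw [Int.card_Icc] at hcard
  have hle : (discreteRange x n : ℤ) ≤ ⌊b⌋ + 1 - ⌈a⌉ := by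
    unfold discreteRange
    omega
  have hle' : (discreteRange x n : ℝ) ≤ ⌊b⌋ + 1 - ⌈a⌉ := by exact_mod_cast hle
  linarith [Int.floor_le b, Int.le_ceil a]

/-- If `u n / n → ℓ`, then `u n` stays within `ε * n` of `ℓ * n` up to an additive constant. -/
lemma exists_forall_abs_sub_mul_le {u : ℕ → ℝ} {ℓ ε : ℝ} (hε : 0 < ε)
    (hlim : Tendsto (fun n : ℕ => u n / n) atTop (nhds ℓ)) :
    ∃ C : ℝ, ∀ k : ℕ, |u k - ℓ * k| ≤ ε * k + C := by
  obtain ⟨N, hN⟩ := Metric.tendsto_atTop.mp hlim ε hε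
  have hC : 0 ≤ ∑ k ∈ Finset.range (N + 1), |u k - ℓ * k| :=
    Finset.sum_nonneg fun _ _ => abs_nonneg _
  refine ⟨∑ k ∈ Finset.range (N + 1), |u k - ℓ * k|, fun k => ?_⟩
  rcases lt_or_ge k (N + 1) with hk | hk
  · have := Finset.single_le_sum (f := fun k : ℕ => |u k - ℓ * k|)
      (fun _ _ => abs_nonneg _) (Finset.mem_range.mpr hk)
    have : 0 ≤ ε * k := by positivity
    linarith
  · have hk0 : (0 : ℝ) < k := by exact_mod_cast (by omega : 0 < k)
    have h := hN k (by omega)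
    rw [Real.dist_eq, div_sub' hk0.ne', abs_div, abs_of_pos hk0, div_lt_iff₀ hk0,
      mul_comm (k : ℝ) ℓ] at h
    linarith

theorem discrete_range_asymptotics
    (x : ℕ → ℤ)
    (hstep : ∀ n : ℕ, |x (n + 1) - x n| ≤ 1)
    (ℓ : ℝ)
    (hlim : Tendsto (fun n : ℕ => (x n : ℝ) / n) atTop (nhds ℓ)) :
    Tendsto (fun n : ℕ => (discreteRange x n : ℝ) / n) atTop (nhds |ℓ|) := by
  refine tendsto_order.mpr ⟨fun a ha => ?_, fun a ha => ?_⟩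
  · have hlow : Tendsto (fun n : ℕ => |(x n : ℝ) / n - (x 0 : ℝ) / n|) atTop (nhds |ℓ|) := by
      simpa using (hlim.sub (tendsto_const_div_atTop_nhds_zero_nat (x 0 : ℝ))).abs
    filter_upwards [hlow.eventually_const_lt ha] with n hn
    refine hn.trans_le ?_
    rw [← sub_div, abs_div, Nat.abs_cast]
    gcongr
    exact (abs_sub_lt_discreteRange hstep n).le
  · obtain ⟨b, hb, hba⟩ := exists_between ha
    obtain ⟨C, hC⟩ := exists_forall_abs_sub_mul_le (ε := (b - |ℓ|) / 2) (by linarith) hlim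
    have hup : Tendsto (fun n : ℕ => b + (2 * C + 1) / n) atTop (nhds b) := by
      simpa using (tendsto_const_div_atTop_nhds_zero_nat (2 * C + 1)).const_add b
    filter_upwards [hup.eventually_lt_const hba, eventually_gt_atTop 0] with n hn hn0
    refine lt_of_le_of_lt ?_ hn
    have hn0' : (0 : ℝ) < n := by exact_mod_cast hn0
    have hmem : ∀ k ≤ n, (x k : ℝ) ∈
        Set.Icc (min 0 (ℓ * n) - ((b - |ℓ|) / 2 * n + C))
          (max 0 (ℓ * n) + ((b - |ℓ|) / 2 * n + C)) := by
      intro k hk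
      have hkn : (k : ℝ) ≤ n := by exact_mod_cast hk
      have hk0 : (0 : ℝ) ≤ k := k.cast_nonneg
      have hx := abs_le.mp (hC k)
      have hε : (b - |ℓ|) / 2 * k ≤ (b - |ℓ|) / 2 * n :=
        mul_le_mul_of_nonneg_left hkn (by linarith)
      have hℓ : min 0 (ℓ * n) ≤ ℓ * k ∧ ℓ * k ≤ max 0 (ℓ * n) := by
        rcases le_total 0 ℓ with h | h
        · exact ⟨(min_le_left _ _).trans (by positivity),
            (mul_le_mul_of_nonneg_left hkn h).trans (le_max_right _ _)⟩
        · exact ⟨(min_le_right _ _).trans (mul_le_mul_of_nonpos_left hkn h),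
            (mul_nonpos_of_nonpos_of_nonneg h hk0).trans (le_max_left _ _)⟩
      constructor <;> linarith [hℓ.1, hℓ.2]
    have hr := discreteRange_le_of_forall_mem_Icc hmem
    have hwidth : max 0 (ℓ * n) - min 0 (ℓ * n) = |ℓ| * n := by
      rw [max_sub_min_eq_abs, sub_zero, abs_mul, Nat.abs_cast]
    rw [div_le_iff₀ hn0', add_mul, div_mul_cancel₀ _ hn0'.ne']
    linarith
end

section
/- Let f, ψ : [0,∞) → ℝ be functions such that ψ is positive, increasing, and tends to +∞ as t → ∞, suppose f is continuous, and let ℓ > 0. If f(t)/ψ(t) → ℓ as t → ∞, then (sup_{0≤s≤t} f(s)) / f(t) → 1 as t → ∞. -/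
open Filter Set

/-- If `f / ψ → ℓ > 0` with `ψ` positive, monotone and unbounded, then the running supremum of `f`
is also asymptotic to `ℓ * ψ`. -/
theorem tendsto_runningSup_div {f ψ : ℝ → ℝ} (hf : ContinuousOn f (Set.Ici 0))
    (hψpos : ∀ t, 0 ≤ t → 0 < ψ t) (hψmono : MonotoneOn ψ (Set.Ici 0))
    (hψtop : Tendsto ψ atTop atTop) {ℓ : ℝ} (hℓ : 0 < ℓ)
    (hlim : Tendsto (fun t => f t / ψ t) atTop (nhds ℓ)) :
    Tendsto (fun t => sSup (f '' Set.Icc 0 t) / ψ t) atTop (nhds ℓ) := by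
  have hbdd (t : ℝ) : BddAbove (f '' Set.Icc 0 t) :=
    (isCompact_Icc.image_of_continuousOn (hf.mono Set.Icc_subset_Ici_self)).bddAbove
  refine tendsto_order.2 ⟨fun a ha => ?_, fun b hb => ?_⟩
  · filter_upwards [(tendsto_order.1 hlim).1 a ha, eventually_ge_atTop 0] with t hat ht
    have hψt := hψpos t ht
    refine hat.trans_le ?_
    gcongr
    exact le_csSup (hbdd t) ⟨t, ⟨ht, le_rfl⟩, rfl⟩
  · obtain ⟨c, hℓc, hcb⟩ := exists_between hb
    have hc : 0 < c := hℓ.trans hℓc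
    obtain ⟨T, hT⟩ := eventually_atTop.1
      (((tendsto_order.1 hlim).2 c hℓc).and (eventually_ge_atTop 0))
    obtain ⟨M, hM⟩ := hbdd T
    filter_upwards [(hψtop.const_mul_atTop hc).eventually_ge_atTop M,
      eventually_ge_atTop 0] with t hMt ht
    have hψt := hψpos t ht
    refine lt_of_le_of_lt ?_ hcb
    rw [div_le_iff₀ hψt]
    refine csSup_le ⟨f t, t, ⟨ht, le_rfl⟩, rfl⟩ ?_
    rintro _ ⟨s, hs, rfl⟩
    rcases le_total s T with hsT | hTs
    · exact (hM ⟨s, ⟨hs.1, hsT⟩, rfl⟩).trans hMt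
    · calc f s ≤ c * ψ s := ((div_lt_iff₀ (hψpos s hs.1)).1 (hT s hTs).1).le
        _ ≤ c * ψ t := by
          gcongr
          exact hψmono hs.1 ht hs.2

theorem runningSup_div_self_tendsto_one
    (f ψ : ℝ → ℝ) (hf : Continuous f)
    (hψpos : ∀ t, 0 ≤ t → 0 < ψ t)
    (hψmono : StrictMonoOn ψ (Set.Ici 0))
    (hψtop : Tendsto ψ atTop atTop)
    (ℓ : ℝ) (hℓ : 0 < ℓ)
    (hlim : Tendsto (fun t => f t / ψ t) atTop (nhds ℓ)) :
    Tendsto (fun t => sSup (f '' Set.Icc 0 t) / f t) atTop (nhds 1) := by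
  have h := (tendsto_runningSup_div hf.continuousOn hψpos hψmono.monotoneOn hψtop hℓ hlim).div
    hlim hℓ.ne'
  rw [div_self hℓ.ne'] at h
  refine h.congr' ?_
  filter_upwards [eventually_ge_atTop 0] with t ht
  exact div_div_div_cancel_right₀ (hψpos t ht).ne' _ _
end
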